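/- Let m ≥ 1, let S be an m×m real symmetric positive-definite matrix, let A be an m×m real matrix such that SA is antisymmetric (i.e. (SA)ᵀ = −SA), set B = S + A, and let κ ∈ ℝ with κ ≠ 0. Then there is no twice continuously differentiable function v : ℝᵐ → ℝ such that v is bounded, its gradient ∇v is bounded, and −(∑_{i=1}^{m} ∂²v/∂x_i²)(x) + ⟨Bx, ∇v(x)⟩ = κ for every x ∈ ℝᵐ (⟨·,·⟩ the Euclidean inner product). -/

import Mathlib

open Matrix

lemma aux_second_deriv {φ ψ : ℝ → ℝ} {d : ℝ} (h1 : ∀ t, HasDerivAt φ (ψ t) t)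
    (h2 : HasDerivAt ψ d 0) (hmin : ∀ t, φ 0 ≤ φ t) : 0 ≤ d := by
  by_contra hd
  push Not at hd
  have e1 : deriv φ = ψ := funext fun t => (h1 t).deriv
  have hm : IsLocalMin φ 0 := Filter.Eventually.of_forall hmin
  have hM : IsLocalMax φ 0 := isLocalMax_of_deriv_deriv_neg
    (by rw [e1, h2.deriv]; exact hd) hm.deriv_eq_zero (h1 0).continuousAt
  have hc : φ =ᶠ[nhds 0] fun _ => φ 0 := by
    filter_upwards [hM] with t ht
    exact le_antisymm ht (hmin t)
  have h3 : deriv φ =ᶠ[nhds 0] fun _ => 0 := by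
    have := hc.deriv
    simpa using this
  rw [e1] at h3
  have := h3.deriv_eq
  rw [h2.deriv] at this
  simp at this
  linarith

lemma aux_coercive {m : ℕ} (T : EuclideanSpace ℝ (Fin m) →L[ℝ] EuclideanSpace ℝ (Fin m))
    (hpos : ∀ x, x ≠ 0 → 0 < inner ℝ (T x) x) :
    ∃ c : ℝ, 0 < c ∧ ∀ x, c * ‖x‖ ^ 2 ≤ inner ℝ (T x) x := by
  have hcont : Continuous fun x => inner ℝ (T x) x := by fun_prop
  by_cases hne : (Metric.sphere (0 : EuclideanSpace ℝ (Fin m)) 1).Nonempty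
  · obtain ⟨z, hz, hzmin⟩ := (isCompact_sphere (0 : EuclideanSpace ℝ (Fin m)) 1).exists_isMinOn
      hne hcont.continuousOn
    have hz0 : z ≠ 0 := by
      rintro rfl
      simp at hz
    refine ⟨_, hpos z hz0, fun x => ?_⟩
    by_cases hx : x = 0
    · simp [hx]
    have hn : 0 < ‖x‖ := norm_pos_iff.mpr hx
    have := hzmin (show ‖x‖⁻¹ • x ∈ Metric.sphere 0 1 by
      simp [norm_smul, hn.ne'])
    simp only [Set.mem_ofPred_eq, map_smul, inner_smul_left, inner_smul_right] at this
    simp only [conj_trivial] at this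
    calc _ ≤ (‖x‖⁻¹ * (‖x‖⁻¹ * inner ℝ (T x) x)) * ‖x‖ ^ 2 := by gcongr
      _ = _ := by field_simp
  · refine ⟨1, one_pos, fun x => ?_⟩
    by_cases hx : x = 0
    · simp [hx]
    have hn : 0 < ‖x‖ := norm_pos_iff.mpr hx
    exact absurd ⟨‖x‖⁻¹ • x, by simp [norm_smul, hn.ne']⟩ hne

lemma aux_main {m : ℕ} (T : EuclideanSpace ℝ (Fin m) →L[ℝ] EuclideanSpace ℝ (Fin m))
    (L : EuclideanSpace ℝ (Fin m) → EuclideanSpace ℝ (Fin m))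
    (hsymm : ∀ x y, inner ℝ (T x) y = inner ℝ x (T y))
    (hpos : ∀ x, x ≠ 0 → 0 < inner ℝ (T x) x)
    (hL : ∀ x, 0 ≤ inner ℝ (T x) (L x)) (κ : ℝ)
    (v : EuclideanSpace ℝ (Fin m) → ℝ) (hv : ContDiff ℝ 2 v) (C : ℝ) (hC : ∀ x, |v x| ≤ C)
    (heq : ∀ x : EuclideanSpace ℝ (Fin m),
          -(∑ i : Fin m, fderiv ℝ (fun y => fderiv ℝ v y (EuclideanSpace.single i 1))
              x (EuclideanSpace.single i 1))
            + fderiv ℝ v x (L x) = κ) : κ ≤ 0 := by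
  obtain ⟨c, hc, hcW⟩ := aux_coercive T hpos
  set K : ℝ := ∑ i : Fin m,
    2 * inner ℝ (T (EuclideanSpace.single i 1)) (EuclideanSpace.single i (1:ℝ)) with hK
  have key : ∀ ε : ℝ, 0 < ε → κ ≤ ε * K := by
    intro ε hε
    have hvd : Differentiable ℝ v := hv.differentiable (by norm_num)
    have hcont : Continuous fun x => v x + ε * inner ℝ (T x) x := by
      have := hv.continuous
      fun_prop
    have htend : Filter.Tendsto (fun x => v x + ε * inner ℝ (T x) x)
        (Filter.cocompact _) Filter.atTop := by
      have h0 : Filter.Tendsto (fun x : EuclideanSpace ℝ (Fin m) => -C + ε * c * ‖x‖ ^ 2)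
          (Filter.cocompact _) Filter.atTop := by
        apply Filter.tendsto_atTop_add_const_left
        apply Filter.Tendsto.const_mul_atTop (by positivity)
        exact (Filter.tendsto_pow_atTop (by norm_num)).comp
          (tendsto_norm_cocompact_atTop (E := EuclideanSpace ℝ (Fin m)))
      refine Filter.tendsto_atTop_mono (fun x => ?_) h0
      have h1 := (abs_le.mp (hC x)).1
      have h2 := mul_le_mul_of_nonneg_left (hcW x) hε.le
      nlinarith
    obtain ⟨x, hx⟩ := hcont.exists_forall_le htend
    have hline : ∀ e : EuclideanSpace ℝ (Fin m), ∀ t : ℝ,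
        HasDerivAt (fun t : ℝ => x + t • e) e t := by
      intro e t
      simpa using ((hasDerivAt_id t).smul_const e).const_add x
    have hφ : ∀ e : EuclideanSpace ℝ (Fin m), ∀ t : ℝ,
        HasDerivAt (fun t : ℝ => v (x + t • e) + ε * inner ℝ (T (x + t • e)) (x + t • e))
          (fderiv ℝ v (x + t • e) e + ε * (2 * inner ℝ (T (x + t • e)) e)) t := by
      intro e t
      have h1 := (hvd (x + t • e)).hasFDerivAt.comp_hasDerivAt t (hline e t)
      have h2 := T.hasFDerivAt.comp_hasDerivAt t (hline e t)
      have h3 := (h2.inner ℝ (hline e t)).const_mul ε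
      refine (h1.add h3).congr_deriv ?_
      simp only [Function.comp]
      rw [hsymm e, real_inner_comm _ e]
      ring
    have hfirst : ∀ e, fderiv ℝ v x e + ε * (2 * inner ℝ (T x) e) = 0 := by
      intro e
      have hm : IsLocalMin
          (fun t : ℝ => v (x + t • e) + ε * inner ℝ (T (x + t • e)) (x + t • e)) 0 := by
        refine Filter.Eventually.of_forall fun t => ?_
        simpa using hx (x + t • e)
      simpa using hm.hasDerivAt_eq_zero (hφ e 0)
    have hsecond : ∀ e, 0 ≤ fderiv ℝ (fun y => fderiv ℝ v y e) x e
        + ε * (2 * inner ℝ (T e) e) := by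
      intro e
      have hd2 : Differentiable ℝ (fun y => fderiv ℝ v y e) := by
        have : ContDiff ℝ 1 (fderiv ℝ v) := hv.fderiv_right (by norm_num)
        have := this.differentiable (by norm_num)
        fun_prop
      refine aux_second_deriv (hφ e) ?_ (fun t => by simpa using hx (x + t • e))
      have h1 := (hd2 (x + (0:ℝ) • e)).hasFDerivAt.comp_hasDerivAt (0:ℝ) (hline e 0)
      have h2 := T.hasFDerivAt.comp_hasDerivAt (0:ℝ) (hline e 0)
      have h3 := ((h2.inner ℝ (hasDerivAt_const (0:ℝ) e)).const_mul 2).const_mul ε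
      refine (h1.add h3).congr_deriv ?_
      simp
    have hsum : 0 ≤ ∑ i : Fin m, (fderiv ℝ (fun y => fderiv ℝ v y (EuclideanSpace.single i 1))
              x (EuclideanSpace.single i 1) + ε * (2 * inner ℝ (T (EuclideanSpace.single i 1))
              (EuclideanSpace.single i (1:ℝ)))) :=
      Finset.sum_nonneg fun i _ => hsecond _
    rw [Finset.sum_add_distrib, ← Finset.mul_sum, ← hK] at hsum
    have h1 := heq x
    have h2 := hfirst (L x)
    have h3 := mul_nonneg hε.le (hL x)
    linarith
  by_contra hκ
  push Not at hκ
  have hKp : 0 < K := by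
    have := key 1 one_pos
    linarith
  have := key (κ / (2 * K)) (by positivity)
  have e : κ / (2 * K) * K = κ / 2 := by field_simp
  linarith

/-- Nonexistence of bounded solutions with bounded gradient of
`Δₑ v + ⟨Bx, ∇v⟩ = κ` on `ℝᵐ` (with `Δₑ = −∑ ∂²/∂xᵢ²`) when `B = S + A` with `S`
symmetric positive definite, `S·A` antisymmetric, and `κ ≠ 0`. -/
theorem stmt_14 (m : ℕ) (hm : 1 ≤ m) (S A B : Matrix (Fin m) (Fin m) ℝ)
    (hS_symm : S.IsSymm) (hS_pos : S.PosDef)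
    (hSA : (S * A)ᵀ = -(S * A)) (hB : B = S + A)
    (κ : ℝ) (hκ : κ ≠ 0) :
    ¬ ∃ v : EuclideanSpace ℝ (Fin m) → ℝ,
        ContDiff ℝ 2 v ∧
        (∃ C : ℝ, ∀ x, |v x| ≤ C) ∧
        (∃ C : ℝ, ∀ x, ‖fderiv ℝ v x‖ ≤ C) ∧
        (∀ x : EuclideanSpace ℝ (Fin m),
          -(∑ i : Fin m, fderiv ℝ (fun y => fderiv ℝ v y (EuclideanSpace.single i 1))
              x (EuclideanSpace.single i 1))
            + fderiv ℝ v x (Matrix.toEuclideanLin B x) = κ) := by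
  rintro ⟨v, hv, ⟨C, hC⟩, -, heq⟩
  set T : EuclideanSpace ℝ (Fin m) →L[ℝ] EuclideanSpace ℝ (Fin m) :=
    LinearMap.toContinuousLinearMap (Matrix.toEuclideanLin S) with hT
  have hTx : ∀ x, T x = Matrix.toEuclideanLin S x := fun x => rfl
  have hsymm : ∀ x y, inner ℝ (T x) y = inner ℝ x (T y) := by
    intro x y
    exact (Matrix.isSymmetric_toEuclideanLin_iff.mpr hS_pos.isHermitian) x y
  have hpos : ∀ x, x ≠ 0 → 0 < inner ℝ (T x) x := by
    intro x hx
    have := hS_pos.dotProduct_mulVec_pos (x := x.ofLp) (by simpa using hx)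
    rw [hsymm, hTx, EuclideanSpace.inner_eq_star_dotProduct, Matrix.ofLp_toEuclideanLin_apply,
      dotProduct_comm]
    exact this
  have hTA : ∀ x, inner ℝ (T x) (Matrix.toEuclideanLin A x) = 0 := by
    intro x
    have h1 : inner ℝ (T x) (Matrix.toEuclideanLin A x)
        = x.ofLp ⬝ᵥ ((S * A) *ᵥ x.ofLp) := by
      rw [hsymm, hTx, EuclideanSpace.inner_eq_star_dotProduct, Matrix.ofLp_toEuclideanLin_apply,
        Matrix.ofLp_toEuclideanLin_apply, dotProduct_comm, Matrix.mulVec_mulVec]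
      simp
    have h2 : x.ofLp ⬝ᵥ ((S * A) *ᵥ x.ofLp) = x.ofLp ⬝ᵥ ((S * A)ᵀ *ᵥ x.ofLp) := by
      rw [Matrix.mulVec_transpose, Matrix.dotProduct_mulVec, dotProduct_comm]
    rw [hSA, Matrix.neg_mulVec, dotProduct_neg] at h2
    linarith
  have hL : ∀ x, 0 ≤ inner ℝ (T x) (Matrix.toEuclideanLin B x) := by
    intro x
    rw [hB, map_add, LinearMap.add_apply, inner_add_right, hTA, ← hTx, add_zero]
    exact real_inner_self_nonneg
  have h1 := aux_main T _ hsymm hpos hL κ v hv C hC heq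
  have h2 := aux_main T _ hsymm hpos hL (-κ) (fun x => -v x) hv.neg C (by simpa using hC) (by
    intro x
    rw [← heq x]
    simp [fderiv_fun_neg]
    ring)
  exact hκ (by linarith)
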